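/- Fix a natural number d ≥ 2 and a real 0 < r < 1, and define M₀ = M₀(d,r) = ⌈ max{ 1, (√(2π)·e·(2(1−√r)²·log d + 1)) / ((1−√r)·√(2·log d)) · d^{(1−√r)²} } · 8·log d ⌉. Assume M₀ ≤ d. Consider the distributed sparse normal means model with machines i = 1,…,M₀: machine i observes x_{i,j} = μ_j + ε_{i,j} for j ∈ [d], where the ε_{i,j} are i.i.d. standard Gaussian N(0,1), μ₁ ≥ √(2r·log d) and μ_j = 0 for all j ≠ 1. For each coordinate j ∈ [d] define the vote count v_j = #{ i ∈ [M₀] : x_{i,j} > x_{i,k} for all k ≠ j }. Then with probability at least 1 − d^{−1} − e³·d^{−3}, both v₁ ≥ 4·log d and v_j ≤ 4·log d for every j ≠ 1 (so coordinate 1 receives at least as many votes as every other coordinate, with strict majority whenever 4·log d is not an integer). -/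

import Mathlib

open MeasureTheory ProbabilityTheory Real
open scoped Classical ENNReal

/-- Independent coordinates of a product measure can be grouped into rows. -/
theorem measurePreserving_curry {ι κ X : Type*} [Fintype ι] [Fintype κ] [MeasurableSpace X]
    (ν : Measure X) [IsProbabilityMeasure ν] :
    MeasurePreserving (MeasurableEquiv.curry ι κ X) (Measure.pi fun _ : ι × κ => ν)
      (Measure.pi fun _ : ι => Measure.pi fun _ : κ => ν) := by
  refine ⟨MeasurableEquiv.measurable _, ?_⟩
  simp_rw [← Measure.infinitePi_eq_pi]
  exact Measure.infinitePi_map_curry (fun _ : ι => fun _ : κ => ν)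

section Chernoff

variable {ι Y : Type*} [Fintype ι]

theorem exp_mul_card_filter_mem (A : Set Y) (t : ℝ) (ω : ι → Y) :
    exp (t * ((Finset.univ.filter fun i => ω i ∈ A).card : ℝ)) =
      ∏ i, (1 + A.indicator (fun _ => exp t - 1) (ω i)) := by
  rw [Finset.card_filter, Nat.cast_sum, Finset.mul_sum, exp_sum]
  refine Finset.prod_congr rfl fun i _ => ?_
  by_cases h : ω i ∈ A <;> simp [h]

variable [MeasurableSpace Y] (ν : Measure Y) [IsProbabilityMeasure ν]

theorem measurable_card_filter_mem {A : Set Y} (hA : MeasurableSet A) :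
    Measurable fun ω : ι → Y => ((Finset.univ.filter fun i => ω i ∈ A).card : ℝ) := by
  simp_rw [Finset.card_filter, Nat.cast_sum]
  refine Finset.measurable_sum _ fun i _ => ?_
  refine (measurable_from_top (f := fun n : ℕ => (n : ℝ))).comp ?_
  exact Measurable.ite (measurable_pi_apply i hA) measurable_const measurable_const

theorem integrable_exp_mul_card_filter_mem {A : Set Y} (hA : MeasurableSet A) (t : ℝ) :
    Integrable (fun ω : ι → Y =>
      exp (t * ((Finset.univ.filter fun i => ω i ∈ A).card : ℝ))) (Measure.pi fun _ => ν) := by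
  refine Integrable.of_bound
    ((measurable_card_filter_mem hA).const_mul t).exp.aestronglyMeasurable
    (exp (|t| * Fintype.card ι)) (.of_forall fun ω => ?_)
  rw [norm_of_nonneg (exp_pos _).le]
  gcongr
  · exact le_abs_self t
  · exact_mod_cast Finset.card_le_univ _

theorem mgf_card_filter_mem_le {A : Set Y} (hA : MeasurableSet A) (t : ℝ) :
    mgf (fun ω : ι → Y => ((Finset.univ.filter fun i => ω i ∈ A).card : ℝ))
      (Measure.pi fun _ => ν) t ≤ exp (Fintype.card ι * ν.real A * (exp t - 1)) := by
  have key : ∫ y, (1 + A.indicator (fun _ => exp t - 1) y) ∂ν = 1 + ν.real A * (exp t - 1) := by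
    rw [integral_add (integrable_const _) ((integrable_const _).indicator hA),
      integral_indicator_const _ hA]
    simp
  have nonneg : 0 ≤ ∫ y, (1 + A.indicator (fun _ => exp t - 1) y) ∂ν := by
    refine integral_nonneg fun y => ?_
    by_cases h : y ∈ A <;> simp [h, (exp_pos t).le]
  simp_rw [mgf, exp_mul_card_filter_mem]
  rw [integral_fintype_prod_eq_pow (fun y => 1 + A.indicator (fun _ => exp t - 1) y)]
  calc _ ≤ (exp (ν.real A * (exp t - 1))) ^ Fintype.card ι := by
        gcongr
        rw [key, add_comm]
        exact add_one_le_exp _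
    _ = _ := by rw [← exp_nat_mul, mul_assoc]

/-- Chernoff bound for the upper tail of the number of coordinates falling in a set. -/
theorem measureReal_le_card_filter_mem {A : Set Y} (hA : MeasurableSet A) {t : ℝ} (ht : 0 ≤ t)
    (c : ℝ) :
    (Measure.pi fun _ : ι => ν).real
      {ω | c ≤ ((Finset.univ.filter fun i => ω i ∈ A).card : ℝ)} ≤
      exp (-t * c + Fintype.card ι * ν.real A * (exp t - 1)) := by
  rw [exp_add]
  refine (measure_ge_le_exp_mul_mgf c ht (integrable_exp_mul_card_filter_mem ν hA t)).trans ?_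
  gcongr
  exact mgf_card_filter_mem_le ν hA t

/-- Chernoff bound for the lower tail of the number of coordinates falling in a set. -/
theorem measureReal_card_filter_mem_le {A : Set Y} (hA : MeasurableSet A) {t : ℝ} (ht : t ≤ 0)
    (c : ℝ) :
    (Measure.pi fun _ : ι => ν).real
      {ω | ((Finset.univ.filter fun i => ω i ∈ A).card : ℝ) ≤ c} ≤
      exp (-t * c + Fintype.card ι * ν.real A * (exp t - 1)) := by
  rw [exp_add]
  refine (measure_le_le_exp_mul_mgf c ht (integrable_exp_mul_card_filter_mem ν hA t)).trans ?_
  gcongr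
  exact mgf_card_filter_mem_le ν hA t

end Chernoff

section Gaussian

theorem gaussianPDFReal_zero_one (x : ℝ) :
    gaussianPDFReal 0 1 x = (√(2 * π))⁻¹ * exp (-x ^ 2 / 2) := by
  simp [gaussianPDFReal]

theorem gaussianReal_real_Ici_le {t : ℝ} (ht : 0 ≤ t) :
    (gaussianReal 0 1).real (Set.Ici t) ≤ exp (-t ^ 2 / 2) := by
  have h := measure_ge_le_exp_mul_mgf (μ := gaussianReal 0 1) (X := id) t ht
    (integrable_exp_mul_gaussianReal t)
  rw [mgf_id_gaussianReal] at h
  refine h.trans_eq ?_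
  rw [← exp_add]
  congr 1
  simp
  ring

theorem hasDerivAt_mills (x : ℝ) :
    HasDerivAt (fun x => -(x / (x ^ 2 + 1)) * gaussianPDFReal 0 1 x)
      ((1 - 2 / (x ^ 2 + 1) ^ 2) * gaussianPDFReal 0 1 x) x := by
  simp_rw [gaussianPDFReal_zero_one]
  have hx : x ^ 2 + 1 ≠ 0 := by positivity
  have h1 : HasDerivAt (fun x : ℝ => x ^ 2) (2 * x) x := by simpa using hasDerivAt_pow 2 x
  have h := (((hasDerivAt_id x).div (h1.add_const 1) hx).neg).mul
    (((h1.neg.div_const 2).exp).const_mul (√(2 * π))⁻¹)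
  refine h.congr_deriv ?_
  simp only [Pi.neg_apply, Pi.div_apply, id]
  field_simp
  ring

theorem tendsto_mills :
    Filter.Tendsto (fun x => -(x / (x ^ 2 + 1)) * gaussianPDFReal 0 1 x) Filter.atTop
      (nhds 0) := by
  have h0 : Filter.Tendsto (fun x => gaussianPDFReal 0 1 x) Filter.atTop (nhds 0) := by
    simp_rw [gaussianPDFReal_zero_one]
    rw [← mul_zero (√(2 * π))⁻¹]
    refine Filter.Tendsto.const_mul _ (tendsto_exp_atBot.comp ?_)
    simp_rw [neg_div]
    exact Filter.tendsto_neg_atTop_atBot.comp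
      ((Filter.tendsto_pow_atTop two_ne_zero).atTop_div_const two_pos)
  refine squeeze_zero_norm (fun x => ?_) h0
  rw [norm_mul, norm_of_nonneg (gaussianPDFReal_nonneg 0 1 x)]
  refine mul_le_of_le_one_left (gaussianPDFReal_nonneg 0 1 x) ?_
  rw [norm_neg, norm_eq_abs, abs_div, abs_of_pos (by positivity : 0 < x ^ 2 + 1),
    div_le_one (by positivity), abs_le]
  constructor <;> nlinarith [sq_nonneg (x - 1), sq_nonneg (x + 1)]

/-- Gordon's lower bound for the Gaussian tail. -/
theorem le_gaussianReal_real_Ioi (t : ℝ) :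
    t / (t ^ 2 + 1) * gaussianPDFReal 0 1 t ≤ (gaussianReal 0 1).real (Set.Ioi t) := by
  have hle (x : ℝ) : 2 / (x ^ 2 + 1) ^ 2 ≤ 2 := by
    refine div_le_self two_pos.le (one_le_pow₀ ?_)
    nlinarith [sq_nonneg x]
  have hnn (x : ℝ) : 0 ≤ 2 / (x ^ 2 + 1) ^ 2 := by positivity
  have hint : IntegrableOn (fun x => (1 - 2 / (x ^ 2 + 1) ^ 2) * gaussianPDFReal 0 1 x)
      (Set.Ioi t) := by
    refine Integrable.integrableOn
      ((integrable_gaussianPDFReal 0 1).bdd_mul (c := 1) ?_ (.of_forall fun x => ?_))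
    · exact Measurable.aestronglyMeasurable (by fun_prop)
    · rw [norm_eq_abs, abs_le]
      constructor <;> linarith [hle x, hnn x]
  have h := integral_Ioi_of_hasDerivAt_of_tendsto' (a := t) (fun x _ => hasDerivAt_mills x) hint
    tendsto_mills
  have hq : (gaussianReal 0 1).real (Set.Ioi t) = ∫ x in Set.Ioi t, gaussianPDFReal 0 1 x := by
    rw [measureReal_def, gaussianReal_apply_eq_integral 0 one_ne_zero,
      ENNReal.toReal_ofReal (integral_nonneg fun x => gaussianPDFReal_nonneg 0 1 x)]
  rw [hq]
  calc _ = ∫ x in Set.Ioi t, (1 - 2 / (x ^ 2 + 1) ^ 2) * gaussianPDFReal 0 1 x := by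
        rw [h]; ring
    _ ≤ _ := by
        refine integral_mono hint (integrable_gaussianPDFReal 0 1).integrableOn fun x => ?_
        exact mul_le_of_le_one_left (gaussianPDFReal_nonneg 0 1 x) (by linarith [hnn x])

end Gaussian

section Winner

variable {κ : Type*}

/-- The noise vectors for which `j` is the strict maximizer of the observation `μ + y`. -/
def winSet (μ : κ → ℝ) (j : κ) : Set (κ → ℝ) :=
  {y | ∀ k, k ≠ j → μ k + y k < μ j + y j}

theorem winSet_disjoint (μ : κ → ℝ) {i j : κ} (h : i ≠ j) :
    Disjoint (winSet μ i) (winSet μ j) :=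
  Set.disjoint_left.2 fun _ hi hj => lt_asymm (hi j h.symm) (hj i h)

variable [Fintype κ] (ν : Measure ℝ) [IsProbabilityMeasure ν]

theorem measurableSet_winSet (μ : κ → ℝ) (j : κ) : MeasurableSet (winSet μ j) := by
  simp only [winSet, Set.ofPred_forall]
  exact .iInter fun k => .iInter fun _ => measurableSet_lt (by fun_prop) (by fun_prop)

theorem pi_real_winSet_zero_eq (i j : κ) :
    (Measure.pi fun _ : κ => ν).real (winSet 0 i) =
      (Measure.pi fun _ : κ => ν).real (winSet 0 j) := by
  have h := measurePreserving_piCongrLeft (fun _ : κ => ν) (Equiv.swap i j)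
  rw [measureReal_def, measureReal_def, ← h.measure_preimage_equiv (winSet 0 j)]
  congr 2
  ext y
  have hy : ∀ k, MeasurableEquiv.piCongrLeft (fun _ : κ => ℝ) (Equiv.swap i j) y k =
      y (Equiv.swap i j k) := by
    intro k
    have := Equiv.piCongrLeft_apply_apply (fun _ : κ => ℝ) (Equiv.swap i j) y (Equiv.swap i j k)
    rw [Equiv.swap_apply_self] at this
    exact this
  simp only [winSet, Pi.zero_apply, zero_add, Set.mem_preimage, Set.mem_ofPred_eq, hy,
    Equiv.swap_apply_right]
  constructor
  · intro H k hk
    refine H _ fun h => hk ?_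
    rw [← Equiv.swap_apply_self i j k, h, Equiv.swap_apply_left]
  · intro H k hk
    simpa using H (Equiv.swap i j k) fun h => hk (by
      rw [← Equiv.swap_apply_self i j k, h, Equiv.swap_apply_right])

theorem card_mul_pi_real_winSet_zero_le (j : κ) :
    Fintype.card κ * (Measure.pi fun _ : κ => ν).real (winSet 0 j) ≤ 1 := by
  calc _ = ∑ i : κ, (Measure.pi fun _ : κ => ν).real (winSet 0 i) := by
        simp [pi_real_winSet_zero_eq ν _ j]
    _ = (Measure.pi fun _ : κ => ν).real (⋃ i, winSet 0 i) :=
        (measureReal_iUnion_fintype (fun _ _ h => winSet_disjoint 0 h)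
          (measurableSet_winSet 0)).symm
    _ ≤ 1 := measureReal_le_one

theorem card_mul_pi_real_winSet_le {μ : κ → ℝ} {k0 : κ} (h0 : 0 ≤ μ k0)
    (hμ : ∀ j, j ≠ k0 → μ j = 0) {j : κ} (hj : j ≠ k0) :
    Fintype.card κ * (Measure.pi fun _ : κ => ν).real (winSet μ j) ≤ 1 := by
  refine le_trans ?_ (card_mul_pi_real_winSet_zero_le ν j)
  gcongr
  · finiteness
  intro y hy k hk
  have h := hy k hk
  rw [hμ j hj] at h
  by_cases hk0 : k = k0
  · subst hk0
    simp only [Pi.zero_apply]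
    linarith
  · rwa [hμ k hk0] at h

theorem le_pi_real_winSet {μ : κ → ℝ} {k0 : κ} (hμ : ∀ j, j ≠ k0 → μ j = 0) (a : ℝ) :
    ν.real (Set.Iio a) ^ (Fintype.card κ - 1) * ν.real (Set.Ioi (a - μ k0)) ≤
      (Measure.pi fun _ : κ => ν).real (winSet μ k0) := by
  let s : κ → Set ℝ := fun k => if k = k0 then Set.Ioi (a - μ k0) else Set.Iio a
  have hs : (Measure.pi fun _ : κ => ν).real (Set.univ.pi s) =
      ν.real (Set.Iio a) ^ (Fintype.card κ - 1) * ν.real (Set.Ioi (a - μ k0)) := by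
    rw [measureReal_def, Measure.pi_pi, ENNReal.toReal_prod,
      ← Finset.prod_erase_mul _ _ (Finset.mem_univ k0)]
    congr 1
    · rw [Finset.prod_congr rfl (g := fun _ => ν.real (Set.Iio a)) fun k hk => by
        simp [s, Finset.ne_of_mem_erase hk, measureReal_def]]
      simp [Finset.card_erase_of_mem]
    · simp [s, measureReal_def]
  rw [← hs]
  refine measureReal_mono fun y hy k hk => ?_
  have h1 := hy k0 trivial
  have h2 := hy k trivial
  simp only [s, if_pos, Set.mem_Ioi] at h1
  simp only [s, if_neg hk, Set.mem_Iio] at h2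
  rw [hμ k hk]
  linarith

end Winner

theorem exp_neg_one_le_one_sub_inv_pow {d : ℕ} (hd : 2 ≤ d) :
    exp (-1) ≤ (1 - (d : ℝ)⁻¹) ^ (d - 1) := by
  obtain ⟨n, rfl⟩ : ∃ n, d = n + 1 := ⟨d - 1, by omega⟩
  have hn : (0 : ℝ) < n := by
    have : 0 < n := by omega
    exact_mod_cast this
  have hb : exp (-(1 / n)) ≤ 1 - ((n + 1 : ℕ) : ℝ)⁻¹ := by
    have h1 : 1 - ((n + 1 : ℕ) : ℝ)⁻¹ = n / (n + 1) := by
      push_cast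
      field_simp
      ring
    rw [h1, exp_neg, inv_le_comm₀ (exp_pos _) (by positivity), inv_div]
    refine le_trans (le_of_eq ?_) (add_one_le_exp _)
    field_simp
    ring
  calc exp (-1) = exp (-(1 / n)) ^ n := by
        rw [← exp_nat_mul]
        congr 1
        field_simp
    _ ≤ _ := by
        simp only [Nat.add_sub_cancel]
        gcongr

/-- Lower bound for the probability that a machine votes for the signal coordinate. -/
theorem inv_le_pi_real_winSet {d : ℕ} (hd : 2 ≤ d) {r : ℝ} (hr0 : 0 < r) (hr1 : r < 1)
    {k0 : Fin d} {μ : Fin d → ℝ} (hk0 : √(2 * r * log d) ≤ μ k0)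
    (hμ : ∀ j, j ≠ k0 → μ j = 0) :
    (√(2 * π) * exp 1 * (2 * (1 - √r) ^ 2 * log d + 1) /
        ((1 - √r) * √(2 * log d)) * (d : ℝ) ^ ((1 - √r) ^ 2))⁻¹ ≤
      (Measure.pi fun _ : Fin d => gaussianReal 0 1).real (winSet μ k0) := by
  have hd1 : (1 : ℝ) < d := by exact_mod_cast hd
  have hd0 : (0 : ℝ) < d := by linarith
  have hL : 0 < log d := log_pos hd1
  have hsr : √r < 1 := by rw [sqrt_lt' one_pos]; simpa
  set a := √(2 * log d) with ha
  have ha2 : a ^ 2 = 2 * log d := sq_sqrt (by positivity)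
  have ha0 : 0 < a := by positivity
  set t := (1 - √r) * a with ht
  have ht0 : 0 < t := mul_pos (by linarith) ha0
  have ht2 : 2 * (1 - √r) ^ 2 * log d = t ^ 2 := by rw [ht, mul_pow, ha2]; ring
  have hdt : (d : ℝ) ^ ((1 - √r) ^ 2) = exp (t ^ 2 / 2) := by
    rw [rpow_def_of_pos hd0, ← ht2]
    congr 1
    ring
  have hta : a - μ k0 ≤ t := by
    have : √(2 * r * log d) = √r * a := by
      rw [ha, ← sqrt_mul hr0.le]
      congr 1
      ring
    rw [ht]
    linarith
  have hIio : 1 - (d : ℝ)⁻¹ ≤ (gaussianReal 0 1).real (Set.Iio a) := by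
    rw [← Set.compl_Ici, probReal_compl_eq_one_sub measurableSet_Ici]
    have h := gaussianReal_real_Ici_le ha0.le
    rw [ha2, show -(2 * log d) / 2 = -log d by ring, exp_neg, exp_log hd0] at h
    linarith
  calc _ = exp (-1) * (t / (t ^ 2 + 1) * gaussianPDFReal 0 1 t) := by
        rw [hdt, ht2, gaussianPDFReal_zero_one, neg_div, exp_neg, exp_neg]
        field_simp
    _ ≤ (gaussianReal 0 1).real (Set.Iio a) ^ (Fintype.card (Fin d) - 1) *
          (gaussianReal 0 1).real (Set.Ioi (a - μ k0)) := by
        have := gaussianPDFReal_nonneg 0 1 t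
        refine mul_le_mul ?_ ?_ (by positivity) (by positivity)
        · rw [Fintype.card_fin]
          refine (exp_neg_one_le_one_sub_inv_pow hd).trans (pow_le_pow_left₀ ?_ hIio _)
          linarith [inv_le_one_of_one_le₀ hd1.le]
        · exact (le_gaussianReal_real_Ioi t).trans
            (measureReal_mono (Set.Ioi_subset_Ioi hta))
    _ ≤ _ := le_pi_real_winSet _ hμ a

/-- The two Chernoff bounds combined over all coordinates. -/
theorem one_sub_le_pi_pi_real_votes {d M : ℕ} (hd : 2 ≤ d) (hMd : M ≤ d)
    {k0 : Fin d} {μ : Fin d → ℝ} (h0 : 0 ≤ μ k0) (hμ : ∀ j, j ≠ k0 → μ j = 0)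
    (hp : 8 * log d ≤
      M * (Measure.pi fun _ : Fin d => gaussianReal 0 1).real (winSet μ k0)) :
    1 - (d : ℝ)⁻¹ - exp 3 / (d : ℝ) ^ 3 ≤
      (Measure.pi fun _ : Fin M => Measure.pi fun _ : Fin d => gaussianReal 0 1).real
        {ω | 4 * log d ≤ ((Finset.univ.filter fun i => ω i ∈ winSet μ k0).card : ℝ) ∧
          ∀ j, j ≠ k0 →
            ((Finset.univ.filter fun i => ω i ∈ winSet μ j).card : ℝ) ≤ 4 * log d} := by
  have hd1 : (1 : ℝ) < d := by exact_mod_cast hd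
  have hd0 : (0 : ℝ) < d := by linarith
  have hL : 0 < log d := log_pos hd1
  set ν := Measure.pi fun _ : Fin d => gaussianReal 0 1 with hν
  set P := Measure.pi fun _ : Fin M => ν
  let low : Set (Fin M → Fin d → ℝ) :=
    {ω | ((Finset.univ.filter fun i => ω i ∈ winSet μ k0).card : ℝ) ≤ 4 * log d}
  let high (j : Fin d) : Set (Fin M → Fin d → ℝ) :=
    {ω | 4 * log d ≤ ((Finset.univ.filter fun i => ω i ∈ winSet μ j).card : ℝ)}
  have hlow : P.real low ≤ (d : ℝ)⁻¹ := by
    refine (measureReal_card_filter_mem_le ν (measurableSet_winSet μ k0) (t := -log 2)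
      (neg_nonpos.2 (log_nonneg one_le_two)) (4 * log d)).trans ?_
    rw [← exp_log hd0, ← exp_neg, exp_le_exp, exp_log hd0, Fintype.card_fin, exp_neg,
      exp_log two_pos]
    nlinarith [log_two_lt_d9]
  have hhigh (j : Fin d) (hj : j ≠ k0) : P.real (high j) ≤ exp 3 / (d : ℝ) ^ 4 := by
    refine (measureReal_le_card_filter_mem ν (measurableSet_winSet μ j) zero_le_one
      (4 * log d)).trans ?_
    have hq := card_mul_pi_real_winSet_le (gaussianReal 0 1) h0 hμ hj
    rw [← hν, Fintype.card_fin] at hq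
    have hMq : M * ν.real (winSet μ j) ≤ 1 := le_trans (by gcongr) hq
    have hM0 : 0 ≤ M * ν.real (winSet μ j) := by positivity
    rw [← exp_log (pow_pos hd0 4), ← exp_sub, exp_le_exp, log_pow, Fintype.card_fin]
    push_cast
    nlinarith [exp_one_lt_d9, add_one_le_exp 1]
  set S := {ω : Fin M → Fin d → ℝ |
    4 * log d ≤ ((Finset.univ.filter fun i => ω i ∈ winSet μ k0).card : ℝ) ∧
      ∀ j, j ≠ k0 →
        ((Finset.univ.filter fun i => ω i ∈ winSet μ j).card : ℝ) ≤ 4 * log d}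
  have hcover : Set.univ ⊆ S ∪ (low ∪ ⋃ j ∈ Finset.univ.erase k0, high j) := by
    intro ω _
    by_contra hω
    simp only [Set.mem_union, not_or, Set.mem_iUnion, not_exists, Finset.mem_erase,
      Finset.mem_univ, and_true] at hω
    obtain ⟨h1, h2, h3⟩ := hω
    exact h1 ⟨(not_le.1 h2).le, fun j hj => (not_le.1 (h3 j hj)).le⟩
  have hsum : P.real (⋃ j ∈ Finset.univ.erase k0, high j) ≤ exp 3 / (d : ℝ) ^ 3 := by
    calc _ ≤ ∑ j ∈ Finset.univ.erase k0, P.real (high j) := measureReal_biUnion_finset_le _ _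
      _ ≤ (Finset.univ.erase k0).card • (exp 3 / (d : ℝ) ^ 4) :=
        Finset.sum_le_card_nsmul _ _ _ fun j hj => hhigh j (Finset.ne_of_mem_erase hj)
      _ ≤ d * (exp 3 / (d : ℝ) ^ 4) := by
        rw [nsmul_eq_mul]
        gcongr
        exact (Finset.card_le_univ _).trans_eq (Fintype.card_fin d)
      _ = _ := by field_simp
  have h1 : P.real Set.univ ≤ _ := measureReal_mono hcover
  rw [probReal_univ] at h1
  linarith [measureReal_union_le (μ := P) S (low ∪ ⋃ j ∈ Finset.univ.erase k0, high j),
    measureReal_union_le (μ := P) low (⋃ j ∈ Finset.univ.erase k0, high j)]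

/-- Theorem 3.1a, Top-1 algorithm: in the distributed sparse normal means
model with `M₀(d,r)` machines, a `1`-sparse mean with signal `≥ √(2r log d)` at coordinate
`k0`, and i.i.d. standard Gaussian noise, with probability at least `1 − d⁻¹ − e³ d⁻³` the
coordinate `k0` receives at least `4 log d` votes while every other coordinate receives at
most `4 log d` votes, where machine `i` votes for the coordinate maximizing its sample. -/
theorem top1_support_recovery
    (d : ℕ) (hd : 2 ≤ d) (r : ℝ) (hr0 : 0 < r) (hr1 : r < 1)
    (M₀ : ℕ)
    (hM₀ : M₀ = ⌈(max 1
        (Real.sqrt (2 * Real.pi) * Real.exp 1 * (2 * (1 - Real.sqrt r) ^ 2 * Real.log d + 1) /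
            ((1 - Real.sqrt r) * Real.sqrt (2 * Real.log d)) *
          (d : ℝ) ^ ((1 - Real.sqrt r) ^ 2))) * (8 * Real.log d)⌉₊)
    (hM₀d : M₀ ≤ d)
    (k0 : Fin d) (μ : Fin d → ℝ)
    (hk0 : Real.sqrt (2 * r * Real.log d) ≤ μ k0)
    (hμ : ∀ j, j ≠ k0 → μ j = 0) :
    (Measure.pi fun _ : Fin M₀ × Fin d => gaussianReal 0 1)
      {ε | (4 * Real.log d ≤
              ((Finset.univ.filter fun i : Fin M₀ =>
                  ∀ k, k ≠ k0 → μ k + ε (i, k) < μ k0 + ε (i, k0)).card : ℝ))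
           ∧ ∀ j, j ≠ k0 →
              ((Finset.univ.filter fun i : Fin M₀ =>
                  ∀ k, k ≠ j → μ k + ε (i, k) < μ j + ε (i, j)).card : ℝ) ≤ 4 * Real.log d}
      ≥ ENNReal.ofReal (1 - (d : ℝ)⁻¹ - Real.exp 3 / (d : ℝ) ^ 3) := by
  have hd1 : (1 : ℝ) < d := by exact_mod_cast hd
  have hL : 0 < log d := log_pos hd1
  have hsr : √r < 1 := by rw [sqrt_lt' one_pos]; simpa
  have hp := inv_le_pi_real_winSet hd hr0 hr1 hk0 hμ
  set A := √(2 * π) * exp 1 * (2 * (1 - √r) ^ 2 * log d + 1) /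
    ((1 - √r) * √(2 * log d)) * (d : ℝ) ^ ((1 - √r) ^ 2)
  have hA0 : 0 < A := by
    have : 0 < 1 - √r := by linarith
    positivity
  have hM : A * (8 * log d) ≤ M₀ := by
    rw [hM₀]
    refine le_trans ?_ (Nat.le_ceil _)
    gcongr
    exact le_max_right _ _
  have hMp : 8 * log d ≤
      M₀ * (Measure.pi fun _ : Fin d => gaussianReal 0 1).real (winSet μ k0) :=
    calc _ = A * (8 * log d) * A⁻¹ := by field_simp
      _ ≤ _ := by gcongr
  have h := one_sub_le_pi_pi_real_votes hd hM₀d ((sqrt_nonneg _).trans hk0) hμ hMp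
  have h' := ENNReal.ofReal_le_ofReal h
  rw [ofReal_measureReal, ← (measurePreserving_curry (gaussianReal 0 1)).measure_preimage_equiv]
    at h'
  refine h'.trans_eq ?_
  congr 1
  ext ε
  simp only [Set.mem_preimage, Set.mem_ofPred_eq]
  congr!
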